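/- arXiv:2103.11077 — 11 statements merged into one kernel-verified Lean document; each statement's English description precedes it below -/
import Mathlib

section
/- If n, x, y are positive integers with gcd(n, x) = gcd(n, y), then |F_n(x)| = |F_n(y)|. -/
/-- The permanent of a 2×2 matrix over `ZMod n`. -/
def perm2 {n : ℕ} (A : Matrix (Fin 2) (Fin 2) (ZMod n)) : ZMod n :=
  A 0 0 * A 1 1 + A 0 1 * A 1 0

/-- `F n x` is the number of 2×2 matrices over `ZMod n` with permanent `x mod n`. -/
noncomputable def F (n : ℕ) (x : ℤ) : ℕ :=
  Nat.card {A : Matrix (Fin 2) (Fin 2) (ZMod n) // perm2 A = (x : ZMod n)}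

/-- Every residue is a unit multiple of its gcd with the modulus. -/
lemma ZMod.exists_unit_mul_gcd (n x : ℕ) (hn : 0 < n) :
    ∃ u : (ZMod n)ˣ, (x : ZMod n) = u * (Nat.gcd n x : ℕ) := by
  have : NeZero n := ⟨hn.ne'⟩
  obtain ⟨d, hd, u, hu, hx⟩ := ZMod.eq_unit_mul_divisor (x : ZMod n)
  obtain ⟨u, rfl⟩ := hu
  refine ⟨u, ?_⟩
  suffices hg : Nat.gcd n x = d by rw [hg, hx]
  have hmod : x ≡ (u : ZMod n).val * d [MOD n] := by
    rw [← ZMod.natCast_eq_natCast_iff, Nat.cast_mul, ZMod.natCast_zmod_val, hx]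
  rw [Nat.gcd_comm, hmod.gcd_eq, (ZMod.val_coe_unit_coprime u).gcd_mul_left_cancel,
    Nat.gcd_eq_left hd]

/-- Multiplying the first row of a 2×2 matrix by a unit. -/
def scaleFirstRow {n : ℕ} (w : (ZMod n)ˣ) :
    Matrix (Fin 2) (Fin 2) (ZMod n) ≃ Matrix (Fin 2) (Fin 2) (ZMod n) where
  toFun A := !![w * A 0 0, w * A 0 1; A 1 0, A 1 1]
  invFun A := !![↑w⁻¹ * A 0 0, ↑w⁻¹ * A 0 1; A 1 0, A 1 1]
  left_inv A := by ext i j; fin_cases i <;> fin_cases j <;> simp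
  right_inv A := by ext i j; fin_cases i <;> fin_cases j <;> simp

lemma perm2_scaleFirstRow {n : ℕ} (w : (ZMod n)ˣ) (A : Matrix (Fin 2) (Fin 2) (ZMod n)) :
    perm2 (scaleFirstRow w A) = w * perm2 A := by
  simp only [perm2, scaleFirstRow, Equiv.coe_fn_mk, Matrix.of_apply, Matrix.cons_val_zero,
    Matrix.cons_val_one]
  ring

lemma F_eq_of_unit_mul {n : ℕ} {x y : ℤ} (w : (ZMod n)ˣ) (h : (y : ZMod n) = w * x) :
    F n x = F n y :=
  Nat.card_congr <| (scaleFirstRow w).subtypeEquiv fun A => by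
    rw [perm2_scaleFirstRow, h, Units.mul_right_inj]

theorem F_gcd_invariance (n x y : ℕ) (hn : 0 < n) (hx : 0 < x) (hy : 0 < y)
    (h : Nat.gcd n x = Nat.gcd n y) :
    F n x = F n y := by
  obtain ⟨u, hu⟩ := ZMod.exists_unit_mul_gcd n x hn
  obtain ⟨v, hv⟩ := ZMod.exists_unit_mul_gcd n y hn
  apply F_eq_of_unit_mul (v * u⁻¹)
  rw [Int.cast_natCast, Int.cast_natCast, hu, hv, h, Units.val_mul, mul_assoc,
    Units.inv_mul_cancel_left]
end

section
/- For an odd prime p and k ≥ 1, g_{p^k}(0) = (p^k − p^{k−1})^3, i.e., the number of invertible 2×2 matrices over ℤ/p^kℤ with permanent 0 equals φ(p^k)^3. -/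
/-- `g n x` is the number of invertible 2×2 matrices over `ZMod n` with permanent `x mod n`. -/
noncomputable def g (n : ℕ) (x : ℤ) : ℕ :=
  Nat.card {A : Matrix (Fin 2) (Fin 2) (ZMod n) // IsUnit A ∧ perm2 A = (x : ZMod n)}

theorem isUnit_and_perm2_eq_zero_iff {n : ℕ} (hn : Odd n) (A : Matrix (Fin 2) (Fin 2) (ZMod n)) :
    IsUnit A ∧ perm2 A = 0 ↔
      (IsUnit (A 0 1) ∧ IsUnit (A 1 0) ∧ IsUnit (A 1 1)) ∧ perm2 A = 0 := by
  have h2 : IsUnit (2 : ZMod n) := by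
    exact_mod_cast (ZMod.isUnit_iff_coprime 2 n).2 hn.coprime_two_left
  refine and_congr_left fun h ↦ ?_
  rw [perm2, add_eq_zero_iff_eq_neg] at h
  rw [Matrix.isUnit_iff_isUnit_det, Matrix.det_fin_two]
  have hdet : A 0 0 * A 1 1 - A 0 1 * A 1 0 = -(2 * (A 0 1 * A 1 0)) := by rw [h]; ring
  rw [hdet, IsUnit.neg_iff, IsUnit.mul_iff, IsUnit.mul_iff]
  refine ⟨fun ⟨_, hb, hc⟩ ↦ ⟨hb, hc, ?_⟩, fun ⟨hb, hc, _⟩ ↦ ⟨h2, hb, hc⟩⟩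
  exact isUnit_of_mul_isUnit_right (h ▸ (hb.mul hc).neg)

/-- Invertible matrices of permanent zero over `ZMod n`, with `n` odd, correspond to triples of
units: the last three entries are arbitrary units and determine the first one. -/
noncomputable def unitsTripleEquiv {n : ℕ} (hn : Odd n) :
    {A : Matrix (Fin 2) (Fin 2) (ZMod n) // IsUnit A ∧ perm2 A = 0} ≃
      (ZMod n)ˣ × (ZMod n)ˣ × (ZMod n)ˣ :=
  Equiv.symm <| Equiv.ofBijective
    (fun u ↦ ⟨!![-(u.1 * u.2.1 * ↑u.2.2⁻¹ : ZMod n), u.1; u.2.1, u.2.2],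
      (isUnit_and_perm2_eq_zero_iff hn _).2 (by simp [perm2])⟩) <| by
    constructor
    · rintro ⟨b, c, d⟩ ⟨b', c', d'⟩ h
      have h := Subtype.ext_iff.1 h
      have hb := congrFun (congrFun h 0) 1
      have hc := congrFun (congrFun h 1) 0
      have hd := congrFun (congrFun h 1) 1
      simp_all [Units.ext_iff]
    · rintro ⟨A, hA⟩
      obtain ⟨⟨⟨b, hb⟩, ⟨c, hc⟩, ⟨d, hd⟩⟩, h⟩ := (isUnit_and_perm2_eq_zero_iff hn A).1 hA
      refine ⟨(b, c, d), Subtype.ext ?_⟩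
      have ha : -(A 0 1 * A 1 0 * ↑d⁻¹) = A 0 0 := by
        rw [perm2, ← hd, add_eq_zero_iff_eq_neg] at h
        rw [← neg_mul, ← h, Units.mul_inv_cancel_right]
      ext i j
      fin_cases i <;> fin_cases j <;> simp [ha, hb, hc, hd]

theorem g_zero_of_odd {n : ℕ} (hn : Odd n) : g n 0 = n.totient ^ 3 := by
  have : NeZero n := ⟨hn.pos.ne'⟩
  rw [g, Int.cast_zero, Nat.card_congr (unitsTripleEquiv hn), Nat.card_prod, Nat.card_prod,
    Nat.card_eq_fintype_card, ZMod.card_units_eq_totient]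
  ring

theorem g_zero_odd_prime_pow (p k : ℕ) (hp : p.Prime) (hodd : Odd p) (hk : 1 ≤ k) :
    g (p ^ k) 0 = (p ^ k - p ^ (k - 1)) ^ 3 := by
  rw [g_zero_of_odd hodd.pow, Nat.totient_prime_pow hp hk, Nat.mul_sub_one, ← pow_succ,
    Nat.sub_add_cancel hk]
end

section
/- If a, b ∈ ℕ are positive and coprime, then for every integer x, g_{ab}(x) = g_a(x) · g_b(x). -/
/-- A matrix over a ring isomorphic to `S × T` is a pair of matrices over `S` and `T`. -/
def Matrix.equivProdOfRingEquiv {m n R S T : Type*} [Ring R] [Ring S] [Ring T]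
    (e : R ≃+* S × T) : Matrix m n R ≃ Matrix m n S × Matrix m n T where
  toFun A := (A.map fun r => (e r).1, A.map fun r => (e r).2)
  invFun P := Matrix.of fun i j => e.symm (P.1 i j, P.2 i j)
  left_inv A := by ext i j; simp
  right_inv P := by ext i j <;> simp

theorem Matrix.isUnit_iff_isUnit_equivProdOfRingEquiv {n R S T : Type*} [Fintype n]
    [DecidableEq n] [CommRing R] [CommRing S] [CommRing T] (e : R ≃+* S × T) (A : Matrix n n R) :
    IsUnit A ↔ IsUnit (equivProdOfRingEquiv e A).1 ∧ IsUnit (equivProdOfRingEquiv e A).2 := by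
  have h₁ : (equivProdOfRingEquiv e A).1.det = (e A.det).1 :=
    (((RingHom.fst S T).comp e.toRingHom).map_det A).symm
  have h₂ : (equivProdOfRingEquiv e A).2.det = (e A.det).2 :=
    (((RingHom.snd S T).comp e.toRingHom).map_det A).symm
  rw [isUnit_iff_isUnit_det, isUnit_iff_isUnit_det, isUnit_iff_isUnit_det, h₁, h₂,
    ← Prod.isUnit_iff, MulEquiv.isUnit_map]

theorem perm2_eq_intCast_iff {a b c : ℕ} (e : ZMod c ≃+* ZMod a × ZMod b)
    (A : Matrix (Fin 2) (Fin 2) (ZMod c)) (x : ℤ) :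
    perm2 A = (x : ZMod c) ↔ perm2 (Matrix.equivProdOfRingEquiv e A).1 = (x : ZMod a) ∧
      perm2 (Matrix.equivProdOfRingEquiv e A).2 = (x : ZMod b) := by
  rw [← e.injective.eq_iff, Prod.ext_iff]
  simp [perm2, Matrix.equivProdOfRingEquiv]

theorem g_multiplicative (a b : ℕ) (ha : 0 < a) (hb : 0 < b)
    (hab : Nat.Coprime a b) (x : ℤ) :
    g (a * b) x = g a x * g b x := by
  let e := ZMod.chineseRemainder hab
  unfold g
  rw [← Nat.card_prod]
  refine Nat.card_congr (((Matrix.equivProdOfRingEquiv e).subtypeEquiv fun A => ?_).trans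
    Equiv.subtypeProdEquivProd)
  rw [Matrix.isUnit_iff_isUnit_equivProdOfRingEquiv e, perm2_eq_intCast_iff e]
  exact and_and_and_comm
end

section
/- Let p be a prime, k ≥ 1, and x an integer divisible by p. Then g_{p^k}(x) = g_{p^k}(0). -/
theorem isUnit_apply_zero_zero_of_isNilpotent_perm2 {n : ℕ} {A : Matrix (Fin 2) (Fin 2) (ZMod n)}
    (hA : IsUnit A) (hp : IsNilpotent (perm2 A)) : IsUnit (A 0 0) := by
  rw [Matrix.isUnit_iff_isUnit_det] at hA
  have h : IsUnit (A.det + perm2 A) := hp.isUnit_add_left_of_commute hA (Commute.all _ _)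
  have e : A.det + perm2 A = A 0 0 * (2 * A 1 1) := by
    rw [Matrix.det_fin_two, perm2]; ring
  rw [e] at h
  exact isUnit_of_mul_isUnit_left h

/-- Add `r / A 0 0` to the lower right entry, which raises the permanent by `r` when `A 0 0` is
a unit. -/
noncomputable def shiftPerm {n : ℕ} (r : ZMod n) (A : Matrix (Fin 2) (Fin 2) (ZMod n)) :
    Matrix (Fin 2) (Fin 2) (ZMod n) :=
  !![A 0 0, A 0 1; A 1 0, A 1 1 + r * Ring.inverse (A 0 0)]

theorem shiftPerm_neg_shiftPerm {n : ℕ} (r : ZMod n) (A : Matrix (Fin 2) (Fin 2) (ZMod n)) :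
    shiftPerm (-r) (shiftPerm r A) = A := by
  ext i j
  fin_cases i <;> fin_cases j <;> simp [shiftPerm]

theorem shiftPerm_spec {n : ℕ} {r s : ZMod n} (hr : IsNilpotent r) (hs : IsNilpotent s)
    {A : Matrix (Fin 2) (Fin 2) (ZMod n)} (hA : IsUnit A ∧ perm2 A = s) :
    IsUnit (shiftPerm r A) ∧ perm2 (shiftPerm r A) = s + r := by
  obtain ⟨hu, rfl⟩ := hA
  have ha := Ring.mul_inverse_cancel _ (isUnit_apply_zero_zero_of_isNilpotent_perm2 hu hs)
  rw [Matrix.isUnit_iff_isUnit_det] at hu ⊢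
  constructor
  · have e : (shiftPerm r A).det = A.det + r := by
      simp only [shiftPerm, Matrix.det_fin_two, Matrix.of_apply, Matrix.cons_val]
      linear_combination r * ha
    rw [e]
    exact hr.isUnit_add_left_of_commute hu (Commute.all _ _)
  · simp only [shiftPerm, perm2, Matrix.of_apply, Matrix.cons_val]
    linear_combination r * ha

theorem g_prime_pow_dvd (p k : ℕ) (hp : p.Prime) (hk : 1 ≤ k) (x : ℤ)
    (hx : (p : ℤ) ∣ x) :
    g (p ^ k) x = g (p ^ k) 0 := by
  have hnil : IsNilpotent (x : ZMod (p ^ k)) := by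
    refine ⟨k, ?_⟩
    rw [← Int.cast_pow, ZMod.intCast_zmod_eq_zero_iff_dvd]
    exact_mod_cast pow_dvd_pow_of_dvd hx k
  refine Nat.card_congr
    { toFun := fun A => ⟨shiftPerm (-x) A.1, ?_⟩
      invFun := fun A => ⟨shiftPerm x A.1, ?_⟩
      left_inv := fun A => Subtype.ext ?_
      right_inv := fun A => Subtype.ext (shiftPerm_neg_shiftPerm _ _) }
  · simpa using shiftPerm_spec hnil.neg hnil A.2
  · simpa using shiftPerm_spec hnil (s := 0) IsNilpotent.zero (by simpa using A.2)
  · simpa using shiftPerm_neg_shiftPerm (-(x : ZMod (p ^ k))) A.1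
end

section
/- For every k ≥ 1, g_{2^k}(0) = 0; that is, there is no invertible 2×2 matrix over ℤ/2^kℤ whose permanent is 0. -/
theorem det_eq_perm2_sub {n : ℕ} (A : Matrix (Fin 2) (Fin 2) (ZMod n)) :
    A.det = perm2 A - 2 * (A 0 1 * A 1 0) := by
  rw [Matrix.det_fin_two, perm2]
  ring

theorem not_isUnit_two_zmod_two_pow {k : ℕ} (hk : 1 ≤ k) : ¬ IsUnit (2 : ZMod (2 ^ k)) := by
  intro h
  have : Fact (1 < 2 ^ k) := ⟨Nat.one_lt_two_pow (by omega)⟩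
  have h_zero : (2 : ZMod (2 ^ k)) ^ k = 0 := by
    exact_mod_cast ZMod.natCast_self (2 ^ k)
  exact not_isUnit_zero (h_zero ▸ h.pow k)

theorem g_two_pow_zero (k : ℕ) (hk : 1 ≤ k) : g (2 ^ k) 0 = 0 := by
  have : IsEmpty {A : Matrix (Fin 2) (Fin 2) (ZMod (2 ^ k)) //
      IsUnit A ∧ perm2 A = ((0 : ℤ) : ZMod (2 ^ k))} := by
    refine ⟨fun ⟨A, hA, hperm⟩ => not_isUnit_two_zmod_two_pow hk ?_⟩
    rw [Matrix.isUnit_iff_isUnit_det, det_eq_perm2_sub, hperm, Int.cast_zero, zero_sub,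
      IsUnit.neg_iff] at hA
    exact isUnit_of_mul_isUnit_left hA
  exact Nat.card_of_isEmpty
end

section
/- Let p be a prime, k ≥ 1, and let m, i be integers with p ∤ m and 0 ≤ i. Then g_{p^k}(m·p^i) = g_{p^k}(p^i). -/
theorem perm2_diagonal_mul {n : ℕ} (u : ZMod n) (A : Matrix (Fin 2) (Fin 2) (ZMod n)) :
    perm2 (Matrix.diagonal ![u, 1] * A) = u * perm2 A := by
  simp [perm2, Matrix.diagonal_mul]
  ring

theorem isUnit_diagonal_unit_one {n : ℕ} (u : (ZMod n)ˣ) :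
    IsUnit (Matrix.diagonal ![(u : ZMod n), 1]) := by
  simp [Matrix.isUnit_iff_isUnit_det]

/-- Scaling the first row by a unit shows that `g n` is invariant under multiplication by
integers coprime to `n`. -/
theorem g_mul_of_isCoprime {n : ℕ} {m : ℤ} (h : IsCoprime m n) (x : ℤ) :
    g n (m * x) = g n x := by
  obtain ⟨u, hu⟩ := (ZMod.coe_int_isUnit_iff_isCoprime m n).mpr h.symm
  obtain ⟨D, hD⟩ := isUnit_diagonal_unit_one u
  refine (Nat.card_congr (D.mulLeft.subtypeEquiv fun A => ?_)).symm
  rw [Units.mulLeft_apply, Units.isUnit_units_mul, hD, perm2_diagonal_mul, Int.cast_mul, ← hu,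
    Units.mul_right_inj]

theorem g_prime_pow_mul (p k : ℕ) (hp : p.Prime) (hk : 1 ≤ k)
    (m : ℤ) (i : ℕ) (hm : ¬ (p : ℤ) ∣ m) :
    g (p ^ k) (m * (p : ℤ) ^ i) = g (p ^ k) ((p : ℤ) ^ i) := by
  apply g_mul_of_isCoprime
  push_cast
  exact (((Nat.prime_iff_prime_int.mp hp).coprime_iff_not_dvd.mpr hm).symm).pow_right
end

section
/- Let n ≥ 1 and let k be an integer with gcd(k, n) = 1. Then g_n(k) = g_n(1). -/
theorem isUnit_diagonal_of_isUnit {n : ℕ} {u : ZMod n} (hu : IsUnit u) :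
    IsUnit (Matrix.diagonal ![u, 1]) := by
  rw [Matrix.isUnit_iff_isUnit_det]
  simpa using hu

theorem g_coprime_eq_g_one (n : ℕ) (hn : 1 ≤ n) (k : ℤ) (hk : Int.gcd k n = 1) :
    g n k = g n 1 := by
  have hu : IsUnit (k : ZMod n) := by
    rw [ZMod.coe_int_isUnit_iff_isCoprime, isCoprime_comm]
    exact Int.isCoprime_iff_gcd_eq_one.mpr hk
  obtain ⟨D, hD⟩ := isUnit_diagonal_of_isUnit hu
  refine (Nat.card_congr ((Units.mulLeft D).subtypeEquiv fun A => ?_)).symm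
  rw [Units.mulLeft_apply, Units.isUnit_units_mul, hD, perm2_diagonal_mul, Int.cast_one,
    hu.mul_eq_left]
end

section
/- For every n ≥ 1, |GL_2(ℤ/nℤ)| = Σ_{d | n} φ(n/d) · g_n(d), where the sum is over positive divisors d of n and φ is Euler's totient function. -/
theorem g_eq_of_eq_unit_mul {n : ℕ} {x y : ℤ} (u : (ZMod n)ˣ)
    (h : (y : ZMod n) = u * (x : ZMod n)) : g n y = g n x := by
  have hD : IsUnit (Matrix.diagonal ![(u : ZMod n), 1] : Matrix (Fin 2) (Fin 2) (ZMod n)) := by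
    simp [Matrix.isUnit_iff_isUnit_det]
  have hperm (A : Matrix (Fin 2) (Fin 2) (ZMod n)) :
      perm2 ((hD.unit : Matrix (Fin 2) (Fin 2) (ZMod n)) * A) = (u : ZMod n) * perm2 A := by
    simp [perm2, Matrix.diagonal_mul]
    ring
  refine (Nat.card_congr ((Units.mulLeft hD.unit).subtypeEquiv fun A => ?_)).symm
  simp only [Units.mulLeft_apply, Units.isUnit_units_mul, hperm, h, Units.mul_right_inj]

theorem exists_natCast_eq_unit_mul_gcd (n k : ℕ) [NeZero n] :
    ∃ u : (ZMod n)ˣ, (k : ZMod n) = u * ((n.gcd k : ℕ) : ZMod n) := by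
  obtain ⟨d, hd, v, hv, h⟩ := ZMod.eq_unit_mul_divisor (k : ZMod n)
  obtain ⟨u, rfl⟩ := hv
  have hmod : k ≡ (u : ZMod n).val * d [MOD n] := by
    rw [← ZMod.natCast_eq_natCast_iff]
    simpa using h
  have hgcd : n.gcd k = d := by
    rw [Nat.gcd_comm, hmod.gcd_eq, (ZMod.val_coe_unit_coprime u).gcd_mul_left_cancel,
      Nat.gcd_eq_left hd]
  exact ⟨u, by rw [hgcd, h]⟩

theorem card_GL_eq_sum_range_g (n : ℕ) [NeZero n] :
    Nat.card (GL (Fin 2) (ZMod n)) = ∑ k ∈ Finset.range n, g n k := by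
  classical
  have hG : Nat.card (GL (Fin 2) (ZMod n)) =
      Nat.card {A : Matrix (Fin 2) (Fin 2) (ZMod n) // IsUnit A} :=
    Nat.card_congr Submonoid.unitsTypeEquivIsUnitSubmonoid.toEquiv
  rw [hG, Nat.card_eq_fintype_card, Fintype.card_subtype,
    Finset.card_eq_sum_card_fiberwise (f := fun A => (perm2 A).val) (t := Finset.range n)
      fun A _ => by simpa using ZMod.val_lt (perm2 A)]
  refine Finset.sum_congr rfl fun k hk => ?_
  rw [g, Nat.card_eq_fintype_card, Fintype.card_subtype, Finset.filter_filter]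
  congr 1
  ext A
  simp only [Finset.mem_filter, Finset.mem_univ, true_and, Int.cast_natCast]
  refine and_congr_right fun _ => ⟨fun h => ?_, fun h => ?_⟩
  · rw [← h, ZMod.natCast_zmod_val]
  · rw [h, ZMod.val_cast_of_lt (Finset.mem_range.mp hk)]

theorem card_GL2_eq_sum_totient_mul_g (n : ℕ) (hn : 1 ≤ n) :
    Nat.card (GL (Fin 2) (ZMod n)) = ∑ d ∈ n.divisors, Nat.totient (n / d) * g n d := by
  have : NeZero n := ⟨by omega⟩
  rw [card_GL_eq_sum_range_g,
    ← Finset.sum_fiberwise_of_maps_to (t := n.divisors) (g := fun k => n.gcd k)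
      fun k _ => Nat.mem_divisors.mpr ⟨n.gcd_dvd_left k, this.ne⟩]
  refine Finset.sum_congr rfl fun d hd => ?_
  rw [Nat.totient_div_of_dvd (Nat.dvd_of_mem_divisors hd), ← smul_eq_mul, ← Finset.sum_const]
  refine Finset.sum_congr rfl fun k hk => ?_
  obtain ⟨u, hu⟩ := exists_natCast_eq_unit_mul_gcd n k
  rw [(Finset.mem_filter.mp hk).2] at hu
  exact g_eq_of_eq_unit_mul u (by simpa using hu)
end

section
/- For an odd prime p and k ≥ 1, g_{p^k}(1) = p^{3(k−1)} · (p − 1) · (p^2 + 1). -/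
/-- Over a commutative local ring in which `2` is invertible, the invertible 2×2 matrices with
permanent `1` are parametrized by three families: upper left entry a non-unit; upper left entry a
unit and upper right entry a non-unit; both entries units, with a unit as determinant. -/
theorem IsLocalRing.card_isUnit_perm_eq_one {R : Type*} [CommRing R] [IsLocalRing R] [Finite R]
    (h2 : IsUnit (2 : R)) :
    Nat.card {A : Matrix (Fin 2) (Fin 2) R //
      IsUnit A ∧ A 0 0 * A 1 1 + A 0 1 * A 1 0 = 1} =
    2 * (Nat.card {x : R // ¬ IsUnit x} * Nat.card Rˣ * Nat.card R) + Nat.card Rˣ ^ 3 := by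
  have key : ∀ x y : R, ¬ IsUnit x → IsUnit (1 - 2 * (x * y)) := fun x y hx => by
    have h : IsUnit ((1 - 2 * (x * y)) + 2 * (x * y)) := by simp
    rcases IsLocalRing.isUnit_or_isUnit_of_isUnit_add h with h | h
    · exact h
    · exact absurd (isUnit_of_mul_isUnit_left (isUnit_of_mul_isUnit_right h)) hx
  obtain ⟨t, ht⟩ := h2
  have ht' : 2 * (t⁻¹ : Rˣ).val = 1 := by rw [← ht]; simp
  let N := {x : R // ¬ IsUnit x}
  let f : (N × Rˣ × R) ⊕ (Rˣ × N × R) ⊕ (Rˣ × Rˣ × Rˣ) → Matrix (Fin 2) (Fin 2) R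
    | .inl (n, u, d) => !![n.1, u; (u⁻¹ : Rˣ) * (1 - n.1 * d), d]
    | .inr (.inl (u, n, c)) => !![u, n.1; c, (u⁻¹ : Rˣ) * (1 - n.1 * c)]
    | .inr (.inr (a, b, w)) =>
      !![a, b; (t⁻¹ : Rˣ) * (b⁻¹ : Rˣ) * (1 - w), (a⁻¹ : Rˣ) * (1 - (t⁻¹ : Rˣ) * (1 - w))]
  have hf : ∀ s, IsUnit (f s) ∧ f s 0 0 * f s 1 1 + f s 0 1 * f s 1 0 = 1 := by
    rintro (⟨n, u, d⟩ | ⟨u, n, c⟩ | ⟨a, b, w⟩) <;>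
      rw [Matrix.isUnit_iff_isUnit_det, Matrix.det_fin_two] <;> dsimp [f]
    · have hu := u.mul_inv
      refine ⟨?_, by linear_combination (1 - n.1 * d) * hu⟩
      convert (key n.1 d n.2).neg using 1
      linear_combination -(1 - n.1 * d) * hu
    · have hu := u.mul_inv
      refine ⟨?_, by linear_combination (1 - n.1 * c) * hu⟩
      convert key n.1 c n.2 using 1
      linear_combination (1 - n.1 * c) * hu
    · have ha := a.mul_inv
      have hb := b.mul_inv
      refine ⟨?_, by
        linear_combination (1 - (t⁻¹ : Rˣ) * (1 - w)) * ha + (t⁻¹ : Rˣ) * (1 - w) * hb⟩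
      convert w.isUnit using 1
      linear_combination (1 - (t⁻¹ : Rˣ) * (1 - w)) * ha - (t⁻¹ : Rˣ) * (1 - w) * hb
        - (1 - w) * ht'
  have hinj : Function.Injective f := by
    rintro (⟨n, u, d⟩ | ⟨u, n, c⟩ | ⟨a, b, w⟩) (⟨n', u', d'⟩ | ⟨u', n', c'⟩ | ⟨a', b', w'⟩) h <;>
      have h00 := congrFun (congrFun h 0) 0 <;> have h01 := congrFun (congrFun h 0) 1 <;>
      have h10 := congrFun (congrFun h 1) 0 <;> have h11 := congrFun (congrFun h 1) 1 <;>
      dsimp [f] at h00 h01 h10 h11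
    · simp [Subtype.ext h00, Units.ext h01, h11]
    · exact absurd (h00 ▸ u'.isUnit) n.2
    · exact absurd (h00 ▸ a'.isUnit) n.2
    · exact absurd (h00 ▸ u.isUnit) n'.2
    · simp [Subtype.ext h01, Units.ext h00, h10]
    · exact absurd (h01 ▸ b'.isUnit) n.2
    · exact absurd (h00 ▸ a.isUnit) n'.2
    · exact absurd (h01 ▸ b.isUnit) n'.2
    · obtain rfl := Units.ext h00
      obtain rfl := Units.ext h01
      rw [← Units.val_mul, Units.mul_right_inj, sub_right_inj] at h10
      simp [Units.ext h10]
  have hsurj : ∀ A : Matrix (Fin 2) (Fin 2) R, IsUnit A →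
      A 0 0 * A 1 1 + A 0 1 * A 1 0 = 1 → ∃ s, f s = A := by
    intro A hA hP
    rw [Matrix.isUnit_iff_isUnit_det, Matrix.det_fin_two] at hA
    by_cases h0 : IsUnit (A 0 0)
    · obtain ⟨a, ha⟩ := h0
      have hai := a.inv_mul
      by_cases h1 : IsUnit (A 0 1)
      · obtain ⟨b, hb⟩ := h1
        obtain ⟨w, hw⟩ := hA
        have hbi := b.inv_mul
        refine ⟨.inr (.inr (a, b, w)), ?_⟩
        rw [← ha, ← hb] at hP hw
        have hc : (t⁻¹ : Rˣ) * (1 - w) = b * A 1 0 := by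
          linear_combination b * A 1 0 * ht' - (t⁻¹ : Rˣ).val * hw - (t⁻¹ : Rˣ).val * hP
        ext i j
        fin_cases i <;> fin_cases j <;> simp [f, ha, hb]
        · linear_combination (b⁻¹ : Rˣ).val * hc + A 1 0 * hbi
        · linear_combination -(a⁻¹ : Rˣ).val * hc - (a⁻¹ : Rˣ).val * hP + A 1 1 * hai
      · refine ⟨.inr (.inl (a, ⟨A 0 1, h1⟩, A 1 0)), ?_⟩
        rw [← ha] at hP
        ext i j
        fin_cases i <;> fin_cases j <;> simp [f, ha]
        linear_combination -(a⁻¹ : Rˣ).val * hP + A 1 1 * hai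
    · have h1 : IsUnit (A 0 1) := by
        have h : IsUnit (A 0 0 * A 1 1 + A 0 1 * A 1 0) := by simp [hP]
        rcases IsLocalRing.isUnit_or_isUnit_of_isUnit_add h with h | h
        · exact absurd (isUnit_of_mul_isUnit_left h) h0
        · exact isUnit_of_mul_isUnit_left h
      obtain ⟨b, hb⟩ := h1
      have hbi := b.inv_mul
      refine ⟨.inl (⟨A 0 0, h0⟩, b, A 1 1), ?_⟩
      rw [← hb] at hP
      ext i j
      fin_cases i <;> fin_cases j <;> simp [f, hb]
      linear_combination -(b⁻¹ : Rˣ).val * hP + A 1 0 * hbi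
  have hcard := Nat.card_congr (Equiv.ofBijective
    (fun s => (⟨f s, hf s⟩ : {A : Matrix (Fin 2) (Fin 2) R //
      IsUnit A ∧ A 0 0 * A 1 1 + A 0 1 * A 1 0 = 1}))
    ⟨fun _ _ h => hinj (congrArg Subtype.val h), fun ⟨A, hA, hP⟩ =>
      (hsurj A hA hP).imp fun _ h => Subtype.ext h⟩)
  rw [← hcard, Nat.card_sum, Nat.card_sum]
  simp only [Nat.card_prod, N]
  ring

/-- A prime power modulus with positive exponent gives a local ring. -/
theorem ZMod.isLocalRing_prime_pow {p k : ℕ} (hp : p.Prime) (hk : k ≠ 0) :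
    IsLocalRing (ZMod (p ^ k)) := by
  have : Fact (1 < p ^ k) := ⟨Nat.one_lt_pow hk hp.one_lt⟩
  have : Fact p.Prime := ⟨hp⟩
  have hu : ∀ x : ZMod (p ^ k), IsUnit x ↔ ¬ p ∣ x.val := fun x => by
    conv_lhs => rw [← ZMod.natCast_zmod_val x]
    rw [ZMod.isUnit_iff_coprime, Nat.coprime_pow_right_iff (Nat.pos_of_ne_zero hk),
      Nat.coprime_comm, hp.coprime_iff_not_dvd]
  refine IsLocalRing.of_nonunits_add fun x y hx hy => ?_
  rw [mem_nonunits_iff, hu, not_not] at *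
  rw [ZMod.val_add]
  exact (Nat.dvd_mod_iff (dvd_pow_self p hk)).2 (dvd_add hx hy)

/-- The non-units of `ZMod (p ^ k)`, for `p` prime and `k` positive, number `p ^ (k - 1)`. -/
theorem ZMod.card_nonunits_prime_pow {p k : ℕ} (hp : p.Prime) (hk : 0 < k) :
    Nat.card {x : ZMod (p ^ k) // ¬ IsUnit x} = p ^ (k - 1) := by
  classical
  have : NeZero (p ^ k) := ⟨pow_ne_zero _ hp.ne_zero⟩
  have h1 : Nat.card {x : ZMod (p ^ k) // IsUnit x} = p ^ (k - 1) * (p - 1) := by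
    rw [← Nat.totient_prime_pow hp hk, ← ZMod.card_units_eq_totient, ← Nat.card_eq_fintype_card]
    exact Nat.card_congr (Submonoid.unitsTypeEquivIsUnitSubmonoid (M := ZMod (p ^ k))).symm.toEquiv
  have h2 : Nat.card {x : ZMod (p ^ k) // IsUnit x} + Nat.card {x : ZMod (p ^ k) // ¬ IsUnit x} =
      p ^ k := by
    rw [← Nat.card_sum, Nat.card_congr (Equiv.sumCompl _), Nat.card_zmod]
  rw [h1] at h2
  generalize Nat.card {x : ZMod (p ^ k) // ¬ IsUnit x} = c at h2 ⊢
  clear h1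
  obtain ⟨q, rfl⟩ := Nat.exists_eq_add_of_le' hp.one_le
  obtain ⟨j, rfl⟩ := Nat.exists_eq_add_of_le' hk
  simp only [Nat.add_sub_cancel, zero_add, Nat.succ_eq_add_one] at *
  rw [pow_succ (q + 1) j] at h2
  linear_combination h2

theorem g_one_odd_prime_pow (p k : ℕ) (hp : p.Prime) (hodd : Odd p) (hk : 1 ≤ k) :
    g (p ^ k) 1 = p ^ (3 * (k - 1)) * (p - 1) * (p ^ 2 + 1) := by
  have : NeZero (p ^ k) := ⟨pow_ne_zero _ hp.ne_zero⟩
  have := ZMod.isLocalRing_prime_pow hp (Nat.one_le_iff_ne_zero.1 hk)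
  have h2 : IsUnit (2 : ZMod (p ^ k)) := by
    have := (ZMod.isUnit_iff_coprime 2 (p ^ k)).2 (Nat.coprime_two_left.2 hodd.pow)
    exact_mod_cast this
  have hmain := IsLocalRing.card_isUnit_perm_eq_one h2
  rw [ZMod.card_nonunits_prime_pow hp hk, Nat.card_zmod, Nat.card_eq_fintype_card (α := (ZMod _)ˣ),
    ZMod.card_units_eq_totient, Nat.totient_prime_pow hp hk] at hmain
  unfold g perm2
  rw [Int.cast_one, hmain]
  obtain ⟨q, rfl⟩ := Nat.exists_eq_add_of_le' hp.one_le
  obtain ⟨j, rfl⟩ := Nat.exists_eq_add_of_le' hk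
  simp only [Nat.add_sub_cancel]
  ring
end

section
/- For every k ≥ 1, g_{2^k}(1) = 6 · 8^{k−1}. -/
/-- The points of the quadric `a * d + b * c = 1` over a commutative ring, split according to
whether `a` is a unit (first summand) or not (second summand, in which `b` is a unit). -/
def permOneParam (R : Type*) [CommRing R] :
    (Rˣ × R × R) ⊕ ({a : R // ¬IsUnit a} × Rˣ × R) → Matrix (Fin 2) (Fin 2) R
  | Sum.inl (a, b, c) => !![(a : R), b; c, (↑a⁻¹ : R) * (1 - b * c)]
  | Sum.inr (a, b, d) => !![(a : R), (b : R); (↑b⁻¹ : R) * (1 - a * d), d]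

theorem permOneParam_injective (R : Type*) [CommRing R] :
    Function.Injective (permOneParam R) := by
  have key {A B : Matrix (Fin 2) (Fin 2) R} (h : A = B) (i j : Fin 2) : A i j = B i j := by rw [h]
  rintro (⟨a, b, c⟩ | ⟨⟨a, ha⟩, b, d⟩) (⟨a', b', c'⟩ | ⟨⟨a', ha'⟩, b', d'⟩) h <;>
    have h00 := key h 0 0 <;> have h01 := key h 0 1 <;> have h10 := key h 1 0 <;>
    have h11 := key h 1 1 <;> simp [permOneParam] at h00 h01 h10 h11
  · simp [Units.ext_iff, h00, h01, h10]
  · exact absurd (h00 ▸ a.isUnit) ha'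
  · exact absurd (h00 ▸ a'.isUnit) ha
  · simp [Units.ext_iff, h00, h01, h11]

theorem range_permOneParam (R : Type*) [CommRing R] [IsLocalRing R] :
    Set.range (permOneParam R) = {A | A 0 0 * A 1 1 + A 0 1 * A 1 0 = 1} := by
  ext A
  constructor
  · rintro ⟨⟨a, b, c⟩ | ⟨⟨a, ha⟩, b, d⟩, rfl⟩ <;> simp [permOneParam]
  · intro hA
    rw [Set.mem_ofPred_eq] at hA
    by_cases ha : IsUnit (A 0 0)
    · obtain ⟨u, hu⟩ := ha
      refine ⟨Sum.inl (u, A 0 1, A 1 0), ?_⟩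
      have : (↑u⁻¹ : R) * (1 - A 0 1 * A 1 0) = A 1 1 := by
        rw [Units.inv_mul_eq_iff_eq_mul, hu]
        linear_combination -hA
      ext i j
      fin_cases i <;> fin_cases j <;> simp [permOneParam, hu, this]
    · have hb : IsUnit (A 0 1) := by
        rcases IsLocalRing.isUnit_or_isUnit_of_add_one hA with h | h
        · exact absurd (isUnit_of_mul_isUnit_left h) ha
        · exact isUnit_of_mul_isUnit_left h
      obtain ⟨u, hu⟩ := hb
      refine ⟨Sum.inr (⟨A 0 0, ha⟩, u, A 1 1), ?_⟩
      have : (↑u⁻¹ : R) * (1 - A 0 0 * A 1 1) = A 1 0 := by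
        rw [Units.inv_mul_eq_iff_eq_mul, hu]
        linear_combination -hA
      ext i j
      fin_cases i <;> fin_cases j <;> simp [permOneParam, hu, this]

theorem natCard_units_add_natCard_not_isUnit (R : Type*) [CommRing R] [Finite R] :
    Nat.card Rˣ + Nat.card {a : R // ¬IsUnit a} = Nat.card R := by
  classical
  have e : Rˣ ≃ {a : R // IsUnit a} :=
    Equiv.ofBijective (fun u => ⟨u, u.isUnit⟩)
      ⟨fun u v h => Units.ext (by simpa using h), fun ⟨_, u, hu⟩ => ⟨u, Subtype.ext hu⟩⟩
  rw [Nat.card_congr e, ← Nat.card_sum, Nat.card_congr (Equiv.sumCompl _)]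

theorem ZMod.isNilpotent_two_of_two_pow (k : ℕ) : IsNilpotent (2 : ZMod (2 ^ k)) :=
  ⟨k, by exact_mod_cast ZMod.natCast_self (2 ^ k)⟩

theorem ZMod.isLocalRing_two_pow_succ (m : ℕ) : IsLocalRing (ZMod (2 ^ (m + 1))) := by
  have : Fact (1 < 2 ^ (m + 1)) := ⟨Nat.one_lt_two_pow (Nat.succ_ne_zero m)⟩
  refine .of_isUnit_or_isUnit_one_sub_self fun a => ?_
  obtain ⟨n, rfl⟩ := ZMod.natCast_zmod_surjective a
  rcases Nat.even_or_odd n with hn | hn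
  · obtain ⟨t, rfl⟩ := hn.two_dvd
    right
    push_cast
    exact (Commute.isNilpotent_mul_right (Commute.all _ _)
      (ZMod.isNilpotent_two_of_two_pow (m + 1))).isUnit_one_sub
  · left
    exact (ZMod.isUnit_iff_coprime _ _).2 (hn.coprime_two_right.pow_right _)

theorem isUnit_of_perm2_eq_one {k : ℕ} {A : Matrix (Fin 2) (Fin 2) (ZMod (2 ^ k))}
    (hA : perm2 A = 1) : IsUnit A := by
  rw [Matrix.isUnit_iff_isUnit_det, Matrix.det_fin_two]
  rw [perm2] at hA
  have : A 0 0 * A 1 1 - A 0 1 * A 1 0 = 1 - 2 * (A 0 1 * A 1 0) := by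
    linear_combination hA
  rw [this]
  exact (Commute.isNilpotent_mul_right (Commute.all _ _)
    (ZMod.isNilpotent_two_of_two_pow k)).isUnit_one_sub

theorem g_two_pow_one (k : ℕ) (hk : 1 ≤ k) : g (2 ^ k) 1 = 6 * 8 ^ (k - 1) := by
  obtain ⟨m, rfl⟩ := Nat.exists_eq_add_of_le' hk
  have := ZMod.isLocalRing_two_pow_succ m
  have hset : {A : Matrix (Fin 2) (Fin 2) (ZMod (2 ^ (m + 1))) |
      IsUnit A ∧ perm2 A = ((1 : ℤ) : ZMod (2 ^ (m + 1)))} =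
      Set.range (permOneParam (ZMod (2 ^ (m + 1)))) := by
    rw [range_permOneParam]
    ext A
    rw [Int.cast_one]
    exact ⟨fun h => h.2, fun h => ⟨isUnit_of_perm2_eq_one h, h⟩⟩
  have hN : Nat.card (ZMod (2 ^ (m + 1))) = 2 * 2 ^ m := by rw [Nat.card_zmod, pow_succ']
  have hU : Nat.card (ZMod (2 ^ (m + 1)))ˣ = 2 ^ m := by
    rw [Nat.card_eq_fintype_card, ZMod.card_units_eq_totient,
      Nat.totient_prime_pow_succ Nat.prime_two]
    simp
  have hV := natCard_units_add_natCard_not_isUnit (ZMod (2 ^ (m + 1)))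
  have hV' : Nat.card {a : ZMod (2 ^ (m + 1)) // ¬IsUnit a} = 2 ^ m := by omega
  have hg : g (2 ^ (m + 1)) 1 = Nat.card (Set.range (permOneParam (ZMod (2 ^ (m + 1))))) := by
    rw [← hset]
    rfl
  rw [hg, Nat.card_range_of_injective (permOneParam_injective _), Nat.card_sum]
  simp only [Nat.card_prod, hN, hU, hV', Nat.add_sub_cancel]
  rw [show (8 : ℕ) = 2 ^ 3 by norm_num, ← pow_mul, mul_comm 3 m, pow_mul]
  ring
end

section
/- Let n be an odd positive integer with exactly r distinct prime factors. Then the set of values {g_n(x) : x ∈ ℤ/nℤ} has cardinality at most 2^r. -/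
/-- `gZMod n x` is the number of invertible 2×2 matrices over `ZMod n`
with permanent `x : ZMod n`. -/
noncomputable def gZMod (n : ℕ) (x : ZMod n) : ℕ :=
  Nat.card {A : Matrix (Fin 2) (Fin 2) (ZMod n) // IsUnit A ∧ perm2 A = x}

theorem isUnit_of_forall_castHom_ne_zero {n : ℕ} [NeZero n] {x : ZMod n}
    (h : ∀ (p : ℕ) (hp : p ∣ n), p.Prime → ZMod.castHom hp (ZMod p) x ≠ 0) : IsUnit x := by
  rw [← ZMod.natCast_zmod_val x, ZMod.isUnit_iff_coprime]
  refine Nat.coprime_of_dvd fun p hp hpx hpn => h p hpn hp ?_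
  rw [← ZMod.natCast_zmod_val x, map_natCast]
  exact (ZMod.natCast_eq_zero_iff _ _).2 hpx

theorem castHom_ne_zero_of_isUnit {n p : ℕ} (hp : p.Prime) (hpn : p ∣ n) {x : ZMod n}
    (hx : IsUnit x) : ZMod.castHom hpn (ZMod p) x ≠ 0 := by
  have := Fact.mk hp
  exact (hx.map (ZMod.castHom hpn (ZMod p))).ne_zero

/-- Adding an element that vanishes modulo every prime factor preserves units. -/
theorem isUnit_add_mul_of_castHom_eq_zero {n : ℕ} [NeZero n] {t D : ZMod n}
    (ht : ∀ (p : ℕ) (hp : p ∣ n), p.Prime → ZMod.castHom hp (ZMod p) t = 0)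
    (hD : IsUnit D) (s : ZMod n) : IsUnit (D + t * s) := by
  refine isUnit_of_forall_castHom_ne_zero fun p hpn hp => ?_
  rw [map_add, map_mul, ht p hpn hp, zero_mul, add_zero]
  exact castHom_ne_zero_of_isUnit hp hpn hD

theorem gZMod_le_of_isUnit_mul {n : ℕ} [NeZero n] {u : ZMod n} (hu : IsUnit u) (x : ZMod n) :
    gZMod n x ≤ gZMod n (u * x) := by
  refine Nat.card_le_card_of_injective
    (fun A => ⟨!![u * A.1 0 0, u * A.1 0 1; A.1 1 0, A.1 1 1], ?_, ?_⟩) ?_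
  · have h := A.2.1
    rw [Matrix.isUnit_iff_isUnit_det, Matrix.det_fin_two] at h ⊢
    convert hu.mul h using 1
    simp
    ring
  · have h := A.2.2
    simp only [perm2] at h
    simp [perm2]
    linear_combination u * h
  · rintro ⟨A, hA⟩ ⟨B, hB⟩ h
    simp only [Subtype.mk.injEq] at h
    have h00 := congrFun (congrFun h 0) 0
    have h01 := congrFun (congrFun h 0) 1
    have h10 := congrFun (congrFun h 1) 0
    have h11 := congrFun (congrFun h 1) 1
    simp [hu.mul_right_inj] at h00 h01 h10 h11
    ext i j
    fin_cases i <;> fin_cases j <;> simpa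

theorem gZMod_isUnit_mul {n : ℕ} [NeZero n] {u : ZMod n} (hu : IsUnit u) (x : ZMod n) :
    gZMod n (u * x) = gZMod n x := by
  refine le_antisymm ?_ (gZMod_le_of_isUnit_mul hu x)
  obtain ⟨u, rfl⟩ := hu
  simpa using gZMod_le_of_isUnit_mul (u⁻¹).isUnit (u * x)

theorem gZMod_le_add {n : ℕ} [NeZero n] {t : ZMod n}
    (ht : ∀ (p : ℕ) (hp : p ∣ n), p.Prime → ZMod.castHom hp (ZMod p) t = 0) (x : ZMod n) :
    gZMod n x ≤ gZMod n (x + t) := by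
  refine Nat.card_le_card_of_injective
    (fun A => ⟨!![A.1 0 0, A.1 0 1;
      A.1 1 0 * (1 - t * A.1.det⁻¹), A.1 1 1 * (1 + t * A.1.det⁻¹)], ?_, ?_⟩) ?_
  · have h := A.2.1
    rw [Matrix.isUnit_iff_isUnit_det] at h ⊢
    convert isUnit_add_mul_of_castHom_eq_zero ht h (A.1.det⁻¹ * perm2 A.1) using 1
    generalize A.1.det⁻¹ = e
    simp [Matrix.det_fin_two, perm2]
    ring
  · have h := ZMod.mul_inv_of_unit _ ((Matrix.isUnit_iff_isUnit_det _).1 A.2.1)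
    have hx := A.2.2
    generalize A.1.det⁻¹ = e at h
    simp only [perm2, Matrix.det_fin_two] at h hx
    simp [perm2]
    linear_combination t * h + hx
  · rintro ⟨A, hA, hAx⟩ ⟨B, hB, hBx⟩ h
    rw [Matrix.isUnit_iff_isUnit_det] at hA hB
    have hAi := ZMod.mul_inv_of_unit _ hA
    have hBi := ZMod.mul_inv_of_unit _ hB
    simp only [Subtype.mk.injEq] at h
    have h00 := congrFun (congrFun h 0) 0
    have h01 := congrFun (congrFun h 0) 1
    have h10 := congrFun (congrFun h 1) 0
    have h11 := congrFun (congrFun h 1) 1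
    simp only [Matrix.of_apply, Matrix.cons_val', Matrix.cons_val_zero, Matrix.cons_val_one,
      Matrix.cons_val_fin_one] at h00 h01 h10 h11
    have hdet : A.det = B.det := by
      have hu := isUnit_add_mul_of_castHom_eq_zero ht isUnit_one (-(x * A.det⁻¹ * B.det⁻¹))
      have key : A.det + t * x * A.det⁻¹ = B.det + t * x * B.det⁻¹ := by
        simp only [perm2] at hAx hBx
        generalize A.det⁻¹ = e at *
        generalize B.det⁻¹ = f at *
        rw [Matrix.det_fin_two, Matrix.det_fin_two]
        linear_combination A 0 0 * h11 - A 0 1 * h10 + B 1 1 * (1 + t * f) * h00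
          - B 1 0 * (1 - t * f) * h01 - t * e * hAx + t * f * hBx
      refine hu.mul_left_inj.1 ?_
      linear_combination key + t * x * A.det⁻¹ * hBi - t * x * B.det⁻¹ * hAi
    rw [← hdet] at h10 h11
    have hm : IsUnit (1 - t * A.det⁻¹) := by
      simpa [sub_eq_add_neg] using
        isUnit_add_mul_of_castHom_eq_zero ht isUnit_one (-A.det⁻¹)
    have hp := isUnit_add_mul_of_castHom_eq_zero ht isUnit_one A.det⁻¹
    rw [hm.mul_left_inj] at h10
    rw [hp.mul_left_inj] at h11
    ext i j
    fin_cases i <;> fin_cases j <;> simpa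

theorem gZMod_add {n : ℕ} [NeZero n] {t : ZMod n}
    (ht : ∀ (p : ℕ) (hp : p ∣ n), p.Prime → ZMod.castHom hp (ZMod p) t = 0) (x : ZMod n) :
    gZMod n (x + t) = gZMod n x := by
  refine le_antisymm ?_ (gZMod_le_add ht x)
  have ht' : ∀ (p : ℕ) (hp : p ∣ n), p.Prime → ZMod.castHom hp (ZMod p) (-t) = 0 :=
    fun p hpn hp => by rw [map_neg, ht p hpn hp, neg_zero]
  simpa using gZMod_le_add ht' (x + t)

/-- The prime factors of `n` that divide `x : ZMod n`. -/
def primeSupport (n : ℕ) (x : ZMod n) : Finset ℕ :=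
  n.primeFactors.filter fun p => (x.cast : ZMod p) = 0

theorem mem_primeSupport {n p : ℕ} (hn : n ≠ 0) (hp : p.Prime) (hpn : p ∣ n) (x : ZMod n) :
    p ∈ primeSupport n x ↔ ZMod.castHom hpn (ZMod p) x = 0 := by
  simp [primeSupport, hp, hpn, hn]

theorem gZMod_eq_of_primeSupport_eq {n : ℕ} [NeZero n] {x y : ZMod n}
    (h : primeSupport n x = primeSupport n y) : gZMod n x = gZMod n y := by
  have hn := NeZero.ne n
  obtain ⟨q, hq⟩ : ∃ q : ZMod n, ∀ (p : ℕ) (hpn : p ∣ n), p.Prime →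
      (ZMod.castHom hpn (ZMod p) q = 0 ↔ p ∉ primeSupport n x) := by
    refine ⟨((∏ l ∈ n.primeFactors \ primeSupport n x, l : ℕ) : ZMod n), fun p hpn hp => ?_⟩
    rw [map_natCast, ZMod.natCast_eq_zero_iff, hp.prime.dvd_finsetProd_iff]
    constructor
    · rintro ⟨l, hl, hpl⟩
      rw [Finset.mem_sdiff] at hl
      rw [(Nat.prime_dvd_prime_iff_eq hp (Nat.prime_of_mem_primeFactors hl.1)).1 hpl]
      exact hl.2
    · exact fun hpx => ⟨p, Finset.mem_sdiff.2 ⟨Nat.mem_primeFactors.2 ⟨hp, hpn, hn⟩, hpx⟩, dvd_rfl⟩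
  have unit_add : ∀ z : ZMod n, primeSupport n z = primeSupport n x → IsUnit (z + q) := by
    refine fun z hz => isUnit_of_forall_castHom_ne_zero fun p hpn hp => ?_
    have hq' := hq p hpn hp
    rw [← hz, mem_primeSupport hn hp hpn] at hq'
    rw [map_add]
    by_cases h0 : ZMod.castHom hpn (ZMod p) z = 0
    · rw [h0, zero_add]
      exact fun h' => hq'.1 h' h0
    · rwa [hq'.2 h0, add_zero]
  have ht : ∀ (p : ℕ) (hpn : p ∣ n), p.Prime → ZMod.castHom hpn (ZMod p) (q * (x - y)) = 0 := by
    intro p hpn hp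
    rw [map_mul, map_sub]
    by_cases hpx : p ∈ primeSupport n x
    · rw [(mem_primeSupport hn hp hpn x).1 hpx, (mem_primeSupport hn hp hpn y).1 (h ▸ hpx),
        sub_zero, mul_zero]
    · rw [(hq p hpn hp).2 hpx, zero_mul]
  rw [← gZMod_isUnit_mul (unit_add y h.symm) x, ← gZMod_isUnit_mul (unit_add x rfl) y,
    ← gZMod_add ht ((x + q) * y)]
  congr 1
  ring

theorem card_values_g_odd (n : ℕ) (hn : 0 < n) (hodd : Odd n) (r : ℕ)
    (hr : n.primeFactors.card = r) :
    (Set.range (gZMod n)).ncard ≤ 2 ^ r := by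
  have : NeZero n := ⟨hn.ne'⟩
  have hf : Function.FactorsThrough (gZMod n) (primeSupport n) :=
    fun _ _ h => gZMod_eq_of_primeSupport_eq h
  have hsub : Set.range (gZMod n) ⊆
      (n.primeFactors.powerset.image (Function.extend (primeSupport n) (gZMod n) 0) : Set ℕ) := by
    rintro _ ⟨x, rfl⟩
    rw [Finset.mem_coe, Finset.mem_image]
    exact ⟨primeSupport n x, Finset.mem_powerset.2 (Finset.filter_subset _ _), hf.extend_apply 0 x⟩
  calc (Set.range (gZMod n)).ncard
      ≤ (n.primeFactors.powerset.image (Function.extend (primeSupport n) (gZMod n) 0)).card := by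
        rw [← Set.ncard_coe_finset]
        exact Set.ncard_le_ncard hsub (Finset.finite_toSet _)
    _ ≤ n.primeFactors.powerset.card := Finset.card_image_le
    _ = 2 ^ r := by rw [Finset.card_powerset, hr]
end
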